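/- arXiv:math/9809104 — 8 statements merged into one kernel-verified Lean document; each statement's English description precedes it below -/
import Mathlib

section
/- Let f be an A-valued 3-cocycle on the abelian group B. Then the map φ_f is trilinear and alternating: φ_f is multiplicative in each of its three arguments (e.g. φ_f(x+x',y,z) = φ_f(x,y,z)·φ_f(x',y,z), and similarly in the other two arguments), and φ_f(x,y,z) = 1 whenever two of the three arguments x, y, z coincide. -/
/-- An `A`-valued 3-cocycle on the abelian group `B` (with `A` a trivial `B`-module). -/
def IsThreeCocycle {B A : Type*} [AddCommGroup B] [CommGroup A]
    (f : B → B → B → A) : Prop :=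
  ∀ x y z w : B, f y z w * f x (y + z) w * f x y z = f (x + y) z w * f x y (z + w)

/-- The alternation `φ_f` of a map `f : B³ → A`, obtained by evaluating `f` on the triple
Pontrjagin product of its arguments. -/
def phiAlt {B A : Type*} [AddCommGroup B] [CommGroup A]
    (f : B → B → B → A) (x y z : B) : A :=
  f x y z * f z x y * f y z x * (f x z y)⁻¹ * (f z y x)⁻¹ * (f y x z)⁻¹

/-- Additive form of linearity: evaluate the cocycle on the shuffle product
`[x|u] * [y] * [z]`. -/
theorem phiAlt_add_left_aux {B M : Type*} [AddCommGroup B] [AddCommGroup M]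
    (f : B → B → B → M)
    (hf : ∀ x y z w : B, f y z w + f x (y + z) w + f x y z = f (x + y) z w + f x y (z + w))
    (x u y z : B) :
    f (x + u) y z + f z (x + u) y + f y z (x + u)
        - f (x + u) z y - f z y (x + u) - f y (x + u) z
      = (f x y z + f z x y + f y z x - f x z y - f z y x - f y x z)
        + (f u y z + f z u y + f y z u - f u z y - f z y u - f y u z) := by
  have h0 := hf x u y z
  have h1 := hf x u z y
  have h2 := hf x y u z
  have h3 := hf x y z u
  have h4 := hf x z u y
  have h5 := hf x z y u
  have h6 := hf y x u z
  have h7 := hf y x z u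
  have h8 := hf y z x u
  have h9 := hf z x u y
  have h10 := hf z x y u
  have h11 := hf z y x u
  simp only [add_comm u x, add_comm y x, add_comm z x, add_comm y u, add_comm z u, add_comm z y] at *
  linear_combination (norm := abel) -h0 + h1 + h2 - h3 - h4 + h5 - h6 + h7 - h8 + h9 - h10 + h11

theorem phiAlt_add_left {B A : Type*} [AddCommGroup B] [CommGroup A]
    (f : B → B → B → A) (hf : IsThreeCocycle f) (x u y z : B) :
    phiAlt f (x + u) y z = phiAlt f x y z * phiAlt f u y z := by
  have h := phiAlt_add_left_aux (M := Additive A) (fun a b c => Additive.ofMul (f a b c))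
    (fun x y z w => congrArg Additive.ofMul (hf x y z w)) x u y z
  simp only [← ofMul_mul, ← ofMul_div] at h
  have h' := Additive.ofMul.injective h
  simpa only [phiAlt, div_eq_mul_inv] using h'

theorem phiAlt_cycle {B A : Type*} [AddCommGroup B] [CommGroup A]
    (f : B → B → B → A) (x y z : B) : phiAlt f x y z = phiAlt f y z x := by
  unfold phiAlt
  apply Additive.ofMul.injective
  simp only [ofMul_mul, ofMul_inv]
  abel

theorem phiAlt_self {B A : Type*} [AddCommGroup B] [CommGroup A]
    (f : B → B → B → A) (x z : B) : phiAlt f x x z = 1 := by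
  unfold phiAlt
  apply Additive.ofMul.injective
  simp only [ofMul_mul, ofMul_inv, ofMul_one]
  abel

/-- For any 3-cocycle `f`, the alternation `φ_f` is trilinear and alternating. -/
theorem phiAlt_trilinear_alternating {B A : Type*} [AddCommGroup B] [CommGroup A]
    (f : B → B → B → A) (hf : IsThreeCocycle f) :
    (∀ x x' y z : B, phiAlt f (x + x') y z = phiAlt f x y z * phiAlt f x' y z) ∧
    (∀ x y y' z : B, phiAlt f x (y + y') z = phiAlt f x y z * phiAlt f x y' z) ∧
    (∀ x y z z' : B, phiAlt f x y (z + z') = phiAlt f x y z * phiAlt f x y z') ∧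
    (∀ x z : B, phiAlt f x x z = 1) ∧
    (∀ x y : B, phiAlt f x y y = 1) ∧
    (∀ x y : B, phiAlt f x y x = 1) := by
  refine ⟨phiAlt_add_left f hf, fun x y y' z => ?_, fun x y z z' => ?_, phiAlt_self f,
    fun x y => ?_, fun x y => ?_⟩
  · simp only [phiAlt_cycle f x]
    exact phiAlt_add_left f hf _ _ _ _
  · simp only [← phiAlt_cycle f _ x y]
    exact phiAlt_add_left f hf _ _ _ _
  · rw [phiAlt_cycle]
    exact phiAlt_self f _ _
  · rw [← phiAlt_cycle]
    exact phiAlt_self f _ _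
end

section
/- Let f be an A-valued 3-cocycle on the abelian group B. Then the pair (g_f, h_f) satisfies the weak biextension cocycle conditions: for all b₁,b₂,b₃,c,c₁,c₂,c₃ ∈ B one has g_f(b₂,b₃;c)·g_f(b₁,b₂+b₃;c) = g_f(b₁+b₂,b₃;c)·g_f(b₁,b₂;c); h_f(b;c₂,c₃)·h_f(b;c₁,c₂+c₃) = h_f(b;c₁+c₂,c₃)·h_f(b;c₁,c₂); and the compatibility condition h_f(b₁+b₂;c₁,c₂)·(h_f(b₁;c₁,c₂)·h_f(b₂;c₁,c₂))⁻¹ = g_f(b₁,b₂;c₁+c₂)·(g_f(b₁,b₂;c₁)·g_f(b₁,b₂;c₂))⁻¹. -/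
/-- The partial symmetrization `g_f(x,y;z)`, obtained by shuffling `z` through `(x,y)`. -/
def gSymm {B A : Type*} [AddCommGroup B] [CommGroup A]
    (f : B → B → B → A) (x y z : B) : A :=
  f x y z * f z x y * (f x z y)⁻¹

/-- The partial symmetrization `h_f(x;y,z)`, obtained by shuffling `x` through `(y,z)`. -/
def hSymm {B A : Type*} [AddCommGroup B] [CommGroup A]
    (f : B → B → B → A) (x y z : B) : A :=
  f y x z * (f x y z)⁻¹ * (f y z x)⁻¹

/-- For any 3-cocycle `f`, the pair `(g_f, h_f)` satisfies the weak biextension cocycle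
conditions: the two associativity conditions and the compatibility condition. -/
theorem gSymm_hSymm_weak_biextension {B A : Type*} [AddCommGroup B] [CommGroup A]
    (f : B → B → B → A) (hf : IsThreeCocycle f) :
    (∀ b₁ b₂ b₃ c : B,
        gSymm f b₂ b₃ c * gSymm f b₁ (b₂ + b₃) c
          = gSymm f (b₁ + b₂) b₃ c * gSymm f b₁ b₂ c) ∧
    (∀ b c₁ c₂ c₃ : B,
        hSymm f b c₂ c₃ * hSymm f b c₁ (c₂ + c₃)
          = hSymm f b (c₁ + c₂) c₃ * hSymm f b c₁ c₂) ∧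
    (∀ b₁ b₂ c₁ c₂ : B,
        hSymm f (b₁ + b₂) c₁ c₂ * (hSymm f b₁ c₁ c₂ * hSymm f b₂ c₁ c₂)⁻¹
          = gSymm f b₁ b₂ (c₁ + c₂) * (gSymm f b₁ b₂ c₁ * gSymm f b₁ b₂ c₂)⁻¹) := by
  -- pass to additive notation, where each identity is a signed shuffle of cocycle relations
  obtain ⟨F, hF⟩ : ∃ F : B → B → B → Additive A, ∀ x y z, f x y z = (F x y z).toMul :=
    ⟨fun x y z => Additive.ofMul (f x y z), fun _ _ _ => rfl⟩
  have H : ∀ x y z w : B,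
      F y z w + F x (y + z) w + F x y z = F (x + y) z w + F x y (z + w) := by
    intro x y z w
    have h := hf x y z w
    simp only [hF] at h
    exact h
  simp only [gSymm, hSymm, hF]
  refine ⟨?_, ?_, ?_⟩
  · intro a b c d
    apply Additive.ofMul.injective
    simp only [ofMul_mul, ofMul_inv, ofMul_toMul]
    have h1 := H a b c d
    have h2 := H a b d c
    have h3 := H a d b c
    have h4 := H d a b c
    rw [add_comm d c] at h2
    rw [add_comm d b] at h3
    rw [add_comm d a] at h4
    linear_combination (norm := module) h1 - h2 + h3 - h4
  · intro a b c d
    apply Additive.ofMul.injective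
    simp only [ofMul_mul, ofMul_inv, ofMul_toMul]
    have h1 := H a b c d
    have h2 := H b a c d
    have h3 := H b c a d
    have h4 := H b c d a
    rw [add_comm b a] at h2
    rw [add_comm c a] at h3
    rw [add_comm d a] at h4
    linear_combination (norm := module) h1 - h2 + h3 - h4
  · intro a b c d
    apply Additive.ofMul.injective
    simp only [ofMul_mul, ofMul_inv, ofMul_toMul]
    have h1 := H a b c d
    have h2 := H a c b d
    have h3 := H a c d b
    have h4 := H c a b d
    have h5 := H c a d b
    have h6 := H c d a b
    rw [add_comm c b] at h2
    rw [add_comm d b] at h3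
    rw [add_comm c a] at h4
    rw [add_comm c a, add_comm d b] at h5
    rw [add_comm d a] at h6
    linear_combination (norm := module) h1 - h2 + h3 + h4 - h5 + h6
end

section
/- Let f be a normalized A-valued 3-cocycle on the abelian group B such that φ_f(x,y,z) = 1 for all x,y,z ∈ B. Then λ_f(b₁,b₂) := g_f(b₁,b₂;b₁+b₂)·h_f(b₁;b₁,b₂)·h_f(b₂;b₁,b₂) = 1 for all b₁,b₂ ∈ B, and g_f(b,−b;b) = h_f(−b;b,−b) for all b ∈ B; that is, the triple (g_f, h_f, 1), with the constant map 1 : B → A as trivializing section over the diagonal, satisfies the cocyclic conditions defining an alternating biextension of B × B by A. -/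
/-- For a normalized 3-cocycle `f` with trivial alternation `φ_f`, the map
`λ_f(b₁,b₂) = g_f(b₁,b₂;b₁+b₂)·h_f(b₁;b₁,b₂)·h_f(b₂;b₁,b₂)` is identically `1`, and
`g_f(b,−b;b) = h_f(−b;b,−b)`; i.e. the triple `(g_f, h_f, 1)` satisfies the cocyclic
conditions defining an alternating biextension of `B × B` by `A`. -/
theorem gSymm_hSymm_alternating_structure {B A : Type*} [AddCommGroup B] [CommGroup A]
    (f : B → B → B → A) (hf : IsThreeCocycle f)
    (hnorm : ∀ x y z : B, x = 0 ∨ y = 0 ∨ z = 0 → f x y z = 1)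
    (hphi : ∀ x y z : B, phiAlt f x y z = 1) :
    (∀ b₁ b₂ : B,
        gSymm f b₁ b₂ (b₁ + b₂) * hSymm f b₁ b₁ b₂ * hSymm f b₂ b₁ b₂ = 1) ∧
    (∀ b : B, gSymm f b (-b) b = hSymm f (-b) b (-b)) := by
  refine ⟨fun a b => ?_, fun b => ?_⟩
  · have h := hf a b a b
    rw [add_comm b a] at h
    have h' : f a b (a + b) * f (a + b) a b * (f a (a + b) b)⁻¹ = f b a b * f a b a := by
      rw [mul_inv_eq_iff_eq_mul, mul_comm (f a b (a + b)), ← h, mul_right_comm]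
    unfold gSymm hSymm
    rw [h', mul_inv_cancel, one_mul, mul_inv_cancel_comm, mul_inv_cancel_right]
    exact mul_inv_cancel _
  · have h := hf b (-b) b (-b)
    rw [neg_add_cancel, add_neg_cancel, hnorm b 0 (-b) (by simp), hnorm 0 b (-b) (by simp),
      hnorm b (-b) 0 (by simp), mul_one, mul_one] at h
    unfold gSymm hSymm
    rw [mul_inv_cancel_right, mul_inv_cancel_comm]
    exact eq_inv_of_mul_eq_one_right h
end

section
/- Let (g,h) be a biextension cocycle pair on B with values in A, φ an anti-symmetry datum for (g,h), λ(b₁,b₂) := g(b₁,b₂;b₁+b₂)·h(b₁;b₁,b₂)·h(b₂;b₁,b₂), and c(b,b') := λ(b,b')·φ(b,b'). Then c is an A-valued 2-cocycle on B: c(b₂,b₃)·c(b₁,b₂+b₃) = c(b₁+b₂,b₃)·c(b₁,b₂) for all b₁,b₂,b₃ ∈ B. -/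
/-- A biextension cocycle pair on the abelian group `B` with values in the abelian group `A`:
the pair of partial group laws is associative, commutative, and compatible. -/
def IsBiextCocycle {B A : Type*} [AddCommGroup B] [CommGroup A]
    (g h : B → B → B → A) : Prop :=
  (∀ b₁ b₂ b₃ c : B,
      g b₂ b₃ c * g b₁ (b₂ + b₃) c = g (b₁ + b₂) b₃ c * g b₁ b₂ c) ∧
  (∀ b c₁ c₂ c₃ : B,
      h b c₂ c₃ * h b c₁ (c₂ + c₃) = h b (c₁ + c₂) c₃ * h b c₁ c₂) ∧
  (∀ b₁ b₂ c : B, g b₁ b₂ c = g b₂ b₁ c) ∧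
  (∀ b c₁ c₂ : B, h b c₁ c₂ = h b c₂ c₁) ∧
  (∀ b₁ b₂ c₁ c₂ : B,
      h (b₁ + b₂) c₁ c₂ * (h b₁ c₁ c₂ * h b₂ c₁ c₂)⁻¹
        = g b₁ b₂ (c₁ + c₂) * (g b₁ b₂ c₁ * g b₁ b₂ c₂)⁻¹)

/-- An anti-symmetry datum `φ` for a biextension cocycle pair `(g,h)`. -/
def IsAntiSymmDatum {B A : Type*} [AddCommGroup B] [CommGroup A]
    (g h : B → B → B → A) (φ : B → B → A) : Prop :=
  (∀ b₁ b₂ c : B,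
      φ (b₁ + b₂) c * (φ b₁ c * φ b₂ c)⁻¹ = g b₁ b₂ c * h c b₁ b₂) ∧
  (∀ b c₁ c₂ : B,
      φ b (c₁ + c₂) * (φ b c₁ * φ b c₂)⁻¹ = h b c₁ c₂ * g c₁ c₂ b) ∧
  (∀ b c : B, φ b c = φ c b)

/-- The map `λ(b₁,b₂) = g(b₁,b₂;b₁+b₂)·h(b₁;b₁,b₂)·h(b₂;b₁,b₂)` associated to a biextension
cocycle pair `(g,h)`. -/
def biextLam {B A : Type*} [AddCommGroup B] [CommGroup A]
    (g h : B → B → B → A) (b₁ b₂ : B) : A :=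
  g b₁ b₂ (b₁ + b₂) * h b₁ b₁ b₂ * h b₂ b₁ b₂

/-- The restriction-to-the-diagonal 2-cochain `c(b,b') = λ(b,b')·φ(b,b')` of an anti-symmetric
biextension is an `A`-valued 2-cocycle on `B`. -/
theorem diag_cochain_is_two_cocycle {B A : Type*} [AddCommGroup B] [CommGroup A]
    (g h : B → B → B → A) (φ : B → B → A)
    (hgh : IsBiextCocycle g h) (hφ : IsAntiSymmDatum g h φ) :
    ∀ b₁ b₂ b₃ : B,
      (biextLam g h b₂ b₃ * φ b₂ b₃) * (biextLam g h b₁ (b₂ + b₃) * φ b₁ (b₂ + b₃))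
        = (biextLam g h (b₁ + b₂) b₃ * φ (b₁ + b₂) b₃) * (biextLam g h b₁ b₂ * φ b₁ b₂) := by
  obtain ⟨ag, ah, -, -, co⟩ := hgh
  obtain ⟨p1, p2, -⟩ := hφ
  intro x y z
  have e1 := p2 x y z
  have e2 := p1 x y z
  have e3 := ag x y z (x + y + z)
  have e4 := ah x x y z
  have e5 := ah z x y z
  have e6 := ah y x y z
  have e7 := co y z x (y + z)
  have e8 := co x y (x + y) z
  have e0 : x + (y + z) = x + y + z := (add_assoc x y z).symm
  simp only [biextLam]
  rw [e0] at e7 ⊢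
  apply_fun Additive.ofMul at e1 e2 e3 e4 e5 e6 e7 e8
  apply Additive.ofMul.injective
  simp only [ofMul_mul, ofMul_inv] at *
  linear_combination (norm := abel) e1 - e2 + e3 + e4 + e5 + e6 + e7 - e8
end

section
/- Let (g,h) be a biextension cocycle pair on B with values in A, φ an anti-symmetry datum for (g,h), λ(b₁,b₂) := g(b₁,b₂;b₁+b₂)·h(b₁;b₁,b₂)·h(b₂;b₁,b₂), and c(b,b') := λ(b,b')·φ(b,b'). Then λ(b,b')² = φ(b+b',b+b')·(φ(b,b)·φ(b,b')·φ(b',b)·φ(b',b'))⁻¹ for all b, b' ∈ B; consequently c(b,b')² = φ(b+b',b+b')·(φ(b,b)·φ(b',b'))⁻¹, i.e. the 1-cochain ψ(b) := φ(b,b) satisfies c(b,b')² = ψ(b+b')·(ψ(b)·ψ(b'))⁻¹ and hence trivializes the square of the 2-cocycle c. -/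
theorem diag_aux {M : Type*} [AddCommGroup M]
    (pss pbs pcs pbb pbc pcb pcc gs gb gc hs hb hc : M)
    (e1 : pss + -(pbs + pcs) = gs + hs)
    (e2 : pbs + -(pbb + pbc) = hb + gb)
    (e3 : pcs + -(pcb + pcc) = hc + gc)
    (e4 : hs + -(hb + hc) = gs + -(gb + gc)) :
    2 • (gs + hb + hc) = pss + -(pbb + pbc + pcb + pcc) := by
  have e1' : pss = gs + hs + (pbs + pcs) := by rw [← e1]; abel
  have e2' : pbs = hb + gb + (pbb + pbc) := by rw [← e2]; abel
  have e3' : pcs = hc + gc + (pcb + pcc) := by rw [← e3]; abel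
  have e4' : hs = gs + -(gb + gc) + (hb + hc) := by rw [← e4]; abel
  rw [e1', e2', e3', e4']; abel

/-- For an anti-symmetric biextension `(g,h,φ)` one has
`λ(b,b')² = φ(b+b',b+b')·(φ(b,b)·φ(b,b')·φ(b',b)·φ(b',b'))⁻¹`; consequently the 1-cochain
`ψ(b) = φ(b,b)` trivializes the square of the symmetric 2-cocycle `c(b,b') = λ(b,b')·φ(b,b')`. -/
theorem diag_cochain_square_trivialized {B A : Type*} [AddCommGroup B] [CommGroup A]
    (g h : B → B → B → A) (φ : B → B → A)
    (hgh : IsBiextCocycle g h) (hφ : IsAntiSymmDatum g h φ) :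
    (∀ b b' : B,
        (biextLam g h b b') ^ 2
          = φ (b + b') (b + b') * (φ b b * φ b b' * φ b' b * φ b' b')⁻¹) ∧
    (∀ b b' : B,
        (biextLam g h b b' * φ b b') ^ 2
          = φ (b + b') (b + b') * (φ b b * φ b' b')⁻¹) := by
  obtain ⟨-, -, -, -, hc⟩ := hgh
  obtain ⟨h1, h2, h3⟩ := hφ
  have key : ∀ b b' : B,
        (biextLam g h b b') ^ 2
          = φ (b + b') (b + b') * (φ b b * φ b b' * φ b' b * φ b' b')⁻¹ := fun b b' =>
    diag_aux (M := Additive A) _ _ _ _ _ _ _ _ _ _ _ _ _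
      (h1 b b' (b + b')) (h2 b b b') (h2 b' b b') (hc b b' b b')
  refine ⟨key, fun b b' => ?_⟩
  rw [mul_pow, key, h3 b' b, pow_two]
  simp only [mul_inv]
  calc _ = φ (b + b') (b + b') * ((φ b b)⁻¹ * (φ b' b')⁻¹) *
        ((φ b b')⁻¹ * φ b b') * ((φ b b')⁻¹ * φ b b') := by ac_rfl
    _ = _ := by simp
end

section
/- Let f be an A-valued 4-cocycle on the abelian group B, and define l : B⁴ → A by l(x₁,x₂,x₃,x₄) := ∏_{σ ∈ S₄} f(x_{σ(1)},x_{σ(2)},x_{σ(3)},x_{σ(4)})^{ε(σ)}, the product over all permutations σ of {1,2,3,4} with exponent the sign ε(σ) of σ. Then l is multilinear and alternating: l is multiplicative in each of its four arguments, and l(x₁,x₂,x₃,x₄) = 1 whenever two of the arguments coincide. -/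
/-- An `A`-valued 4-cocycle on the abelian group `B` (with `A` a trivial `B`-module). -/
def IsFourCocycle {B A : Type*} [AddCommGroup B] [CommGroup A]
    (f : B → B → B → B → A) : Prop :=
  ∀ x y z w v : B,
    f y z w v * f x (y + z) w v * f x y z (w + v)
      = f (x + y) z w v * f x y (z + w) v * f x y z w

/-- The full alternation `l(x₁,x₂,x₃,x₄) = ∏_{σ ∈ S₄} f(x_{σ(1)},…,x_{σ(4)})^{ε(σ)}` of a
map `f : B⁴ → A`, i.e. the evaluation of `f` on the quadruple Pontrjagin product. -/
def quadAlt {B A : Type*} [AddCommGroup B] [CommGroup A]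
    (f : B → B → B → B → A) (x₁ x₂ x₃ x₄ : B) : A :=
  ∏ σ : Equiv.Perm (Fin 4),
    (f (![x₁, x₂, x₃, x₄] (σ 0)) (![x₁, x₂, x₃, x₄] (σ 1))
       (![x₁, x₂, x₃, x₄] (σ 2)) (![x₁, x₂, x₃, x₄] (σ 3)))
      ^ ((Equiv.Perm.sign σ : ℤˣ) : ℤ)

/-- The alternation of a function of three variables. -/
def alt3 {B M : Type*} [AddCommGroup M] (g : B → B → B → M) (y z w : B) : M :=
  g y z w - g y w z - g z y w + g z w y + g w y z - g w z y

/-- Insertion of a fourth variable in all four positions, with signs. -/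
def ins4 {B M : Type*} [AddCommGroup M] (f : B → B → B → B → M) (x y z w : B) : M :=
  f x y z w - f y x z w + f y z x w - f y z w x

/-- Sum of the ten cocycle identities in which `y, z, w` occur in this order. -/
lemma shuffle_sum {B M : Type*} [AddCommGroup B] [AddCommGroup M]
    (f : B → B → B → B → M)
    (hf : ∀ x y z w v : B,
      f y z w v - f (x + y) z w v + f x (y + z) w v - f x y (z + w) v
        + f x y z (w + v) - f x y z w = 0) (x x' y z w : B) :
      f x' y z w - f (x + x') y z w - f x x' (y + z) w + f x x' y (z + w) - f x x' y z - f
      y x' z w - f x y x' (z + w) + f x y x' z + f y z x' w + f x (y + z) x' w - f x y z x'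
      - f y z w x' - f x (y + z) w x' + f x y (z + w) x' + f x y z w + f x x' z w + f y (x
      + x') z w + f y x x' (z + w) - f y x x' z - f x z x' w + f y x z x' + f x z w x' - f
      y x (z + w) x' - f y x z w + f z x x' w - f (y + z) x x' w - f y z (x + x') w - f y z
      x x' - f z x w x' + f (y + z) x w x' + f y z x w + f z w x x' - f (y + z) w x x' + f
      y (z + w) x x' + f y z w (x + x') - f y z w x = 0 := by
  have e1 := add_comm y x
  have e2 := add_comm z x
  have e3 := add_comm w x
  have e4 := add_comm y x'
  have e5 := add_comm z x'
  have e6 := add_comm w x'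
  linear_combination (norm := (simp only [e1, e2, e3, e4, e5, e6]; abel))
      hf x x' y z w - hf x y x' z w + hf x y z x' w - hf x y z w x' + hf y x x' z w - hf y
      x z x' w + hf y x z w x' + hf y z x x' w - hf y z x w x' + hf y z w x x'

lemma alt3_ins4_add {B M : Type*} [AddCommGroup B] [AddCommGroup M]
    (f : B → B → B → B → M)
    (hf : ∀ x y z w v : B,
      f y z w v - f (x + y) z w v + f x (y + z) w v - f x y (z + w) v
        + f x y z (w + v) - f x y z w = 0) (x x' y z w : B) :
    alt3 (ins4 f (x + x')) y z w = alt3 (ins4 f x) y z w + alt3 (ins4 f x') y z w := by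
  have h := shuffle_sum f hf x x'
  have e1 := add_comm z y
  have e2 := add_comm w y
  have e3 := add_comm w z
  unfold alt3 ins4
  linear_combination (norm := (simp only [e1, e2, e3]; abel))
    - h y z w + h y w z + h z y w - h z w y - h w y z + h w z y

lemma quadAlt_eq {B A : Type*} [AddCommGroup B] [CommGroup A]
    (f : B → B → B → B → A) (x y z w : B) :
    Additive.ofMul (quadAlt f x y z w)
      = alt3 (ins4 (fun a b c d => Additive.ofMul (f a b c d)) x) y z w := by
  unfold quadAlt alt3 ins4
  rw [Finset.univ_perm_fin_succ, Finset.prod_map, ← Finset.univ_product_univ, Finset.prod_product]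
  simp only [Finset.univ_perm_fin_succ (n := 2), Finset.univ_perm_fin_succ (n := 1),
    Finset.prod_map, ← Finset.univ_product_univ, Finset.prod_product]
  have h42 (p : Fin 4) (e : Equiv.Perm (Fin 3)) :
      Equiv.Perm.decomposeFin.symm (p, e) 2 = Equiv.swap 0 p (e 1).succ :=
    Equiv.Perm.decomposeFin_symm_apply_succ e p 1
  have h43 (p : Fin 4) (e : Equiv.Perm (Fin 3)) :
      Equiv.Perm.decomposeFin.symm (p, e) 3 = Equiv.swap 0 p (e 2).succ :=
    Equiv.Perm.decomposeFin_symm_apply_succ e p 2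
  have h32 (p : Fin 3) (e : Equiv.Perm (Fin 2)) :
      Equiv.Perm.decomposeFin.symm (p, e) 2 = Equiv.swap 0 p (e 1).succ :=
    Equiv.Perm.decomposeFin_symm_apply_succ e p 1
  simp [Fin.prod_univ_succ, Equiv.Perm.decomposeFin.symm_sign, h42, h43, h32,
    Equiv.swap_apply_def]
  abel

/-- For a 4-cocycle `f`, the full alternation `l = quadAlt f` is multilinear and alternating:
it is multiplicative in each of its four arguments, and equals `1` whenever two of the
arguments coincide. -/
theorem quadAlt_multilinear_alternating {B A : Type*} [AddCommGroup B] [CommGroup A]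
    (f : B → B → B → B → A) (hf : IsFourCocycle f) :
    (∀ x x' y z w : B,
        quadAlt f (x + x') y z w = quadAlt f x y z w * quadAlt f x' y z w) ∧
    (∀ x y y' z w : B,
        quadAlt f x (y + y') z w = quadAlt f x y z w * quadAlt f x y' z w) ∧
    (∀ x y z z' w : B,
        quadAlt f x y (z + z') w = quadAlt f x y z w * quadAlt f x y z' w) ∧
    (∀ x y z w w' : B,
        quadAlt f x y z (w + w') = quadAlt f x y z w * quadAlt f x y z w') ∧
    (∀ x z w : B, quadAlt f x x z w = 1) ∧
    (∀ x y w : B, quadAlt f x y x w = 1) ∧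
    (∀ x y z : B, quadAlt f x y z x = 1) ∧
    (∀ x y w : B, quadAlt f x y y w = 1) ∧
    (∀ x y z : B, quadAlt f x y z y = 1) ∧
    (∀ x y z : B, quadAlt f x y z z = 1) := by
  have hadd : ∀ x x' y z w : B,
      quadAlt f (x + x') y z w = quadAlt f x y z w * quadAlt f x' y z w := by
    intro x x' y z w
    apply Additive.ofMul.injective
    rw [ofMul_mul, quadAlt_eq, quadAlt_eq, quadAlt_eq]
    apply alt3_ins4_add
    intro a b c d e
    have h := congrArg Additive.ofMul (hf a b c d e)
    simp only [ofMul_mul] at h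
    linear_combination (norm := abel) h
  have s2 : ∀ x y z w : B, quadAlt f x y z w = (quadAlt f y x z w)⁻¹ := by
    intro x y z w
    apply Additive.ofMul.injective
    rw [ofMul_inv, quadAlt_eq, quadAlt_eq]
    unfold alt3 ins4
    abel
  have s3 : ∀ x y z w : B, quadAlt f x y z w = (quadAlt f z y x w)⁻¹ := by
    intro x y z w
    apply Additive.ofMul.injective
    rw [ofMul_inv, quadAlt_eq, quadAlt_eq]
    unfold alt3 ins4
    abel
  have s4 : ∀ x y z w : B, quadAlt f x y z w = (quadAlt f w y z x)⁻¹ := by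
    intro x y z w
    apply Additive.ofMul.injective
    rw [ofMul_inv, quadAlt_eq, quadAlt_eq]
    unfold alt3 ins4
    abel
  refine ⟨hadd, ?_, ?_, ?_, ?_, ?_, ?_, ?_, ?_, ?_⟩
  · intro x y y' z w
    rw [s2, hadd, mul_inv, ← s2, ← s2]
  · intro x y z z' w
    rw [s3, hadd, mul_inv, ← s3, ← s3]
  · intro x y z w w'
    rw [s4, hadd, mul_inv, ← s4, ← s4]
  all_goals
    intro a b c
    apply Additive.ofMul.injective
    rw [ofMul_one, quadAlt_eq]
    unfold alt3 ins4
    abel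
end

section
/- Let f be a normalized A-valued 4-cocycle on the abelian group B such that l(x₁,x₂,x₃,x₄) := ∏_{σ ∈ S₄} f(x_{σ(1)},x_{σ(2)},x_{σ(3)},x_{σ(4)})^{ε(σ)} = 1 for all x₁,x₂,x₃,x₄ ∈ B. For each fixed w ∈ B define G_w(x,y;z) := ψ_w(x,y,z)·ψ_w(z,x,y)·ψ_w(x,z,y)⁻¹ and H_w(x;y,z) := ψ_w(y,x,z)·(ψ_w(x,y,z)·ψ_w(y,z,x))⁻¹, and for each fixed a ∈ B define Γ_a(y,z;w) := φ_a(y,z,w)·φ_a(w,y,z)·φ_a(y,w,z)⁻¹ and N_a(y;z,w) := φ_a(z,y,w)·(φ_a(y,z,w)·φ_a(z,w,y))⁻¹. Then for each fixed w the pair (G_w, H_w) satisfies all the biextension cocycle conditions, namely the two associativity conditions, the compatibility condition, and both commutativity conditions G_w(x,y;z) = G_w(y,x;z) and H_w(x;y,z) = H_w(x;z,y); and likewise for each fixed a the pair (Γ_a, N_a) satisfies all the biextension cocycle conditions including both commutativity conditions. -/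
/-- The signed shuffle `ψ_w(x,y,z)` of the last variable `w` through the triple `(x,y,z)`. -/
def psiShuffle {B A : Type*} [AddCommGroup B] [CommGroup A]
    (f : B → B → B → B → A) (w x y z : B) : A :=
  f x y z w * f x w y z * (f x y w z * f w x y z)⁻¹

/-- The signed shuffle `φ_a(y,z,w)` of the first variable `a` through the triple `(y,z,w)`. -/
def phiShuffle {B A : Type*} [AddCommGroup B] [CommGroup A]
    (f : B → B → B → B → A) (a y z w : B) : A :=
  f y a z w * f y z w a * (f a y z w * f y z a w)⁻¹

/-- `G_w(x,y;z) = ψ_w(x,y,z)·ψ_w(z,x,y)·ψ_w(x,z,y)⁻¹`. -/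
def Gpart {B A : Type*} [AddCommGroup B] [CommGroup A]
    (f : B → B → B → B → A) (w x y z : B) : A :=
  psiShuffle f w x y z * psiShuffle f w z x y * (psiShuffle f w x z y)⁻¹

/-- `H_w(x;y,z) = ψ_w(y,x,z)·(ψ_w(x,y,z)·ψ_w(y,z,x))⁻¹`. -/
def Hpart {B A : Type*} [AddCommGroup B] [CommGroup A]
    (f : B → B → B → B → A) (w x y z : B) : A :=
  psiShuffle f w y x z * (psiShuffle f w x y z * psiShuffle f w y z x)⁻¹

/-- `Γ_a(y,z;w) = φ_a(y,z,w)·φ_a(w,y,z)·φ_a(y,w,z)⁻¹`. -/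
def GammaPart {B A : Type*} [AddCommGroup B] [CommGroup A]
    (f : B → B → B → B → A) (a y z w : B) : A :=
  phiShuffle f a y z w * phiShuffle f a w y z * (phiShuffle f a y w z)⁻¹

/-- `N_a(y;z,w) = φ_a(z,y,w)·(φ_a(y,z,w)·φ_a(z,w,y))⁻¹`. -/
def Npart {B A : Type*} [AddCommGroup B] [CommGroup A]
    (f : B → B → B → B → A) (a y z w : B) : A :=
  phiShuffle f a z y w * (phiShuffle f a y z w * phiShuffle f a z w y)⁻¹

/-- Expansion of the alternation over `S₄` into the alternation of `ψ_w`. -/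
lemma quadAlt_eq_psi {B A : Type*} [AddCommGroup B] [CommGroup A]
    (f : B → B → B → B → A) (x y z w : B) :
    quadAlt f x y z w =
      psiShuffle f w x y z * psiShuffle f w y z x * psiShuffle f w z x y *
      (psiShuffle f w x z y * psiShuffle f w y x z * psiShuffle f w z y x)⁻¹ := by
  unfold quadAlt psiShuffle
  rw [← Equiv.prod_comp (Equiv.Perm.decomposeFin (n := 3)).symm]
  rw [Fintype.prod_prod_type]
  simp only [Fin.prod_univ_four]
  simp only [← Equiv.prod_comp (Equiv.Perm.decomposeFin (n := 2)).symm, Fintype.prod_prod_type, Fin.prod_univ_three]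
  simp only [← Equiv.prod_comp (Equiv.Perm.decomposeFin (n := 1)).symm, Fintype.prod_prod_type, Fin.prod_univ_two, Fintype.prod_unique]
  have e1 : (1 : Fin 4) = Fin.succ 0 := rfl
  have e2 : (2 : Fin 4) = Fin.succ (Fin.succ 0) := rfl
  have e3 : (3 : Fin 4) = Fin.succ (Fin.succ (Fin.succ 0)) := rfl
  simp only [Equiv.Perm.decomposeFin.symm_sign, e1, e2, e3, Equiv.Perm.decomposeFin_symm_apply_zero,
    Equiv.Perm.decomposeFin_symm_apply_succ]
  simp [Equiv.swap_apply_def]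
  apply Additive.ofMul.injective
  simp only [ofMul_mul, ofMul_inv]
  abel

/-- `ψ_w` is a 3-cocycle. -/
lemma psi_cocycle {B A : Type*} [AddCommGroup B] [CommGroup A]
    (f : B → B → B → B → A) (hf : IsFourCocycle f) (w x y z v : B) :
    psiShuffle f w y z v * psiShuffle f w x (y + z) v * psiShuffle f w x y z =
      psiShuffle f w (x + y) z v * psiShuffle f w x y (z + v) := by
  have h1 := congrArg Additive.ofMul (hf x y z v w)
  have h2 := congrArg Additive.ofMul (hf x y z w v)
  have h3 := congrArg Additive.ofMul (hf x y w z v)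
  have h4 := congrArg Additive.ofMul (hf x w y z v)
  have h5 := congrArg Additive.ofMul (hf w x y z v)
  rw [add_comm w v] at h2
  rw [add_comm w z] at h3
  rw [add_comm w y] at h4
  rw [add_comm w x] at h5
  apply Additive.ofMul.injective
  simp only [psiShuffle, ofMul_mul, ofMul_inv] at *
  linear_combination (norm := abel) h1 - h2 + h3 - h4 + h5

lemma biext_psi {B A : Type*} [AddCommGroup B] [CommGroup A]
    (f : B → B → B → B → A) (hf : IsFourCocycle f)
    (halt : ∀ x₁ x₂ x₃ x₄ : B, quadAlt f x₁ x₂ x₃ x₄ = 1) (w : B) :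
    IsBiextCocycle (Gpart f w) (Hpart f w) := by
  have hc : ∀ x y z v : B, _ := fun x y z v =>
    congrArg Additive.ofMul (psi_cocycle f hf w x y z v)
  have ha : ∀ x y z : B, _ := fun x y z =>
    congrArg Additive.ofMul ((quadAlt_eq_psi f x y z w).symm.trans (halt x y z w))
  simp only [ofMul_mul, ofMul_inv, ofMul_one] at hc ha
  refine ⟨fun b₁ b₂ b₃ c => ?_, fun b c₁ c₂ c₃ => ?_, fun b₁ b₂ c => ?_, fun b c₁ c₂ => ?_,
    fun b₁ b₂ c₁ c₂ => ?_⟩ <;> apply Additive.ofMul.injective <;>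
    simp only [Gpart, Hpart, ofMul_mul, ofMul_inv]
  · have h1 := hc b₁ b₂ b₃ c
    have h2 := hc b₁ b₂ c b₃
    have h3 := hc b₁ c b₂ b₃
    have h4 := hc c b₁ b₂ b₃
    rw [add_comm c b₃] at h2
    rw [add_comm c b₂] at h3
    rw [add_comm c b₁] at h4
    linear_combination (norm := abel) h1 - h2 + h3 - h4
  · have h1 := hc c₁ c₂ c₃ b
    have h2 := hc c₁ c₂ b c₃
    have h3 := hc c₁ b c₂ c₃
    have h4 := hc b c₁ c₂ c₃
    rw [add_comm b c₃] at h2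
    rw [add_comm b c₂] at h3
    rw [add_comm b c₁] at h4
    linear_combination (norm := abel) h2 - h1 - h3 + h4
  · linear_combination (norm := abel) ha b₁ b₂ c
  · linear_combination (norm := abel) -ha b c₁ c₂
  · have h1 := hc b₁ b₂ c₁ c₂
    have h2 := hc b₁ c₁ b₂ c₂
    have h3 := hc b₁ c₁ c₂ b₂
    have h4 := hc c₁ b₁ b₂ c₂
    have h5 := hc c₁ b₁ c₂ b₂
    have h6 := hc c₁ c₂ b₁ b₂
    rw [add_comm c₁ b₂] at h2
    rw [add_comm c₂ b₂] at h3
    rw [add_comm c₁ b₁] at h4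
    rw [add_comm c₁ b₁, add_comm c₂ b₂] at h5
    rw [add_comm c₂ b₁] at h6
    linear_combination (norm := abel) h1 - h2 + h3 + h4 - h5 + h6

/-- Let `f` be a normalized 4-cocycle whose full alternation is trivial.  Then, for every
fixed `w`, the pair `(G_w, H_w)` satisfies all the biextension cocycle conditions, and for
every fixed `a`, so does the pair `(Γ_a, N_a)`. -/
theorem shuffled_pairs_are_biextensions {B A : Type*} [AddCommGroup B] [CommGroup A]
    (f : B → B → B → B → A) (hf : IsFourCocycle f)
    (hnorm : ∀ x y z w : B, x = 0 ∨ y = 0 ∨ z = 0 ∨ w = 0 → f x y z w = 1)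
    (halt : ∀ x₁ x₂ x₃ x₄ : B, quadAlt f x₁ x₂ x₃ x₄ = 1) :
    (∀ w : B, IsBiextCocycle (Gpart f w) (Hpart f w)) ∧
    (∀ a : B, IsBiextCocycle (GammaPart f a) (Npart f a)) := by
  refine ⟨fun w => biext_psi f hf halt w, fun a => ?_⟩
  have e : phiShuffle f = psiShuffle f := by
    funext a y z w
    simp only [phiShuffle, psiShuffle]
    rw [mul_comm (f y a z w), mul_comm (f a y z w)]
  have e1 : GammaPart f a = Gpart f a := by
    funext y z w
    simp only [GammaPart, Gpart, e]
  have e2 : Npart f a = Hpart f a := by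
    funext y z w
    simp only [Npart, Hpart, e]
  rw [e1, e2]
  exact biext_psi f hf halt a
end

section
/- For any abelian group B, the second integral group homology H₂(B;ℤ) of B is isomorphic to the exterior square Λ²_ℤ B of B viewed as a ℤ-module. -/
/-- The degree-2 differential of the inhomogeneous bar complex computing the integral
homology of the abelian group `B` (with trivial coefficients):
`d₂[x,y] = [y] - [x+y] + [x]`. -/
noncomputable def barD2 (B : Type*) [AddCommGroup B] : (B × B →₀ ℤ) →ₗ[ℤ] (B →₀ ℤ) :=
  Finsupp.lsum ℤ fun p =>
    Finsupp.lsingle p.2 - Finsupp.lsingle (p.1 + p.2) + Finsupp.lsingle p.1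

/-- The degree-3 differential of the inhomogeneous bar complex:
`d₃[x,y,z] = [y,z] - [x+y,z] + [x,y+z] - [x,y]`. -/
noncomputable def barD3 (B : Type*) [AddCommGroup B] :
    (B × B × B →₀ ℤ) →ₗ[ℤ] (B × B →₀ ℤ) :=
  Finsupp.lsum ℤ fun p =>
    Finsupp.lsingle (p.2.1, p.2.2) - Finsupp.lsingle (p.1 + p.2.1, p.2.2)
      + Finsupp.lsingle (p.1, p.2.1 + p.2.2) - Finsupp.lsingle (p.1, p.2.1)

/-- The second integral group homology `H₂(B;ℤ)` of the abelian group `B` (for the trivial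
action), computed as `ker d₂ / im d₃` in the bar complex.  Since the degree-1 differential is
zero for trivial coefficients, this is indeed `H₂` of the bar resolution. -/
noncomputable abbrev H2 (B : Type*) [AddCommGroup B] :=
  LinearMap.ker (barD2 B) ⧸
    (LinearMap.range (barD3 B)).comap (LinearMap.ker (barD2 B)).subtype

section helpers

abbrev QZ := AddCircle (1 : ℚ)

/-- The abelian extension attached to a symmetric 2-cocycle: underlying type. -/
structure CocExt {B D : Type*} (f : B → B → D) where
  fst : D
  snd : B

theorem CocExt.ext2 {B D : Type*} {f : B → B → D} {x y : CocExt f}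
    (h1 : x.fst = y.fst) (h2 : x.snd = y.snd) : x = y := by
  cases x; cases y; simp_all

theorem coc_zero_right {B D : Type*} [AddCommGroup B] [AddCommGroup D] {f : B → B → D}
    (hc : ∀ x y z, f y z - f (x + y) z + f x (y + z) - f x y = 0) (x : B) :
    f 0 x = f 0 0 := by
  have h := hc 0 0 x
  simp only [zero_add, sub_self] at h
  exact sub_eq_zero.mp h

/-- The group structure on the extension. -/
@[reducible] def CocExt.grp {B D : Type*} [AddCommGroup B] [AddCommGroup D] (f : B → B → D)
    (hs : ∀ x y, f x y = f y x)
    (hc : ∀ x y z, f y z - f (x + y) z + f x (y + z) - f x y = 0) :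
    AddCommGroup (CocExt f) :=
  letI : Zero (CocExt f) := ⟨⟨-f 0 0, 0⟩⟩
  letI : Add (CocExt f) := ⟨fun a b => ⟨a.fst + b.fst + f a.snd b.snd, a.snd + b.snd⟩⟩
  letI : Neg (CocExt f) := ⟨fun a => ⟨-a.fst - f (-a.snd) a.snd - f 0 0, -a.snd⟩⟩
  have hcomm : ∀ a b : CocExt f, a + b = b + a := by
    intro a b
    apply CocExt.ext2
    · change a.fst + b.fst + f a.snd b.snd = b.fst + a.fst + f b.snd a.snd
      rw [hs a.snd b.snd, add_comm a.fst]
    · exact add_comm a.snd b.snd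
  have hzero : ∀ a : CocExt f, 0 + a = a := by
    intro a
    apply CocExt.ext2
    · change -f 0 0 + a.fst + f 0 a.snd = a.fst
      rw [coc_zero_right hc a.snd]; abel
    · exact zero_add a.snd
  { add_assoc := by
      intro a b c
      apply CocExt.ext2
      · change (a.fst + b.fst + f a.snd b.snd) + c.fst + f (a.snd + b.snd) c.snd
          = a.fst + (b.fst + c.fst + f b.snd c.snd) + f a.snd (b.snd + c.snd)
        have h := hc a.snd b.snd c.snd
        rw [← sub_eq_zero, ← neg_eq_zero, ← h]
        abel
      · exact add_assoc a.snd b.snd c.snd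
    zero_add := hzero
    add_zero := fun a => by rw [hcomm, hzero]
    add_comm := hcomm
    nsmul := nsmulRec
    zsmul := zsmulRec
    neg_add_cancel := by
      intro a
      apply CocExt.ext2
      · change (-a.fst - f (-a.snd) a.snd - f 0 0) + a.fst + f (-a.snd) a.snd = -f 0 0
        abel
      · exact neg_add_cancel a.snd }

/-- Symmetric cocycles with values in `ℚ/ℤ` are coboundaries. -/
theorem sym_coc {B : Type*} [AddCommGroup B] (f : B → B → QZ)
    (hs : ∀ x y, f x y = f y x)
    (hc : ∀ x y z, f y z - f (x + y) z + f x (y + z) - f x y = 0) :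
    ∃ g : B → QZ, ∀ x y, f x y = g x + g y - g (x + y) := by
  letI := CocExt.grp f hs hc
  have hadd : ∀ a b : CocExt f, a + b = ⟨a.fst + b.fst + f a.snd b.snd, a.snd + b.snd⟩ :=
    fun _ _ => rfl
  let i : QZ →+ CocExt f := AddMonoidHom.mk' (fun d => ⟨d - f 0 0, 0⟩) (by
    intro a b
    rw [hadd]
    apply CocExt.ext2
    · change a + b - f 0 0 = a - f 0 0 + (b - f 0 0) + f 0 0
      abel
    · exact (zero_add 0).symm)
  have hi : Function.Injective i := by
    intro a b h
    have h2 : a - f 0 0 = b - f 0 0 := congrArg CocExt.fst h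
    exact sub_left_injective h2
  obtain ⟨ret, hret⟩ :=
    (Module.Baer.of_divisible QZ).extension_property_addMonoidHom i hi (AddMonoidHom.id _)
  refine ⟨fun x => ret ⟨0, x⟩, fun x y => ?_⟩
  have h1 : ret (i (f x y)) = f x y := DFunLike.congr_fun hret (f x y)
  have h2 : (⟨0, x⟩ : CocExt f) + ⟨0, y⟩ = i (f x y) + ⟨0, x + y⟩ := by
    rw [hadd, hadd]
    apply CocExt.ext2
    · change 0 + 0 + f x y = f x y - f 0 0 + 0 + f 0 (x + y)
      rw [coc_zero_right hc (x + y)]; abel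
    · exact (zero_add (x + y)).symm
  have h3 := congrArg ret h2
  rw [map_add, map_add, h1] at h3
  rw [h3]; abel

/-- Every alternating form with values in `ℚ/ℤ` is the antisymmetrization of a cocycle. -/
theorem alt_coc {B : Type*} [AddCommGroup B] (w : B →ₗ[ℤ] B →ₗ[ℤ] QZ)
    (hw : ∀ x, w x x = 0) :
    ∃ f : B → B → QZ, (∀ x y, f x y - f y x = w x y) ∧
      (∀ x y z, f y z - f (x + y) z + f x (y + z) - f x y = 0) := by
  classical
  letI : LinearOrder B := linearOrderOfSTO (WellOrderingRel (α := B))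
  have hanti : ∀ x y, w x y = - w y x := by
    intro x y
    have h := hw (x + y)
    simp only [map_add, LinearMap.add_apply, hw, zero_add, add_zero] at h
    rw [← sub_eq_zero, sub_neg_eq_add]
    first
      | exact h
      | (rw [add_comm]; exact h)
  let p : (B →₀ ℤ) →ₗ[ℤ] B := Finsupp.linearCombination ℤ (id : B → B)
  let c : (B →₀ ℤ) →ₗ[ℤ] (B →₀ ℤ) →ₗ[ℤ] QZ :=
    Finsupp.linearCombination ℤ (fun i => Finsupp.linearCombination ℤ
      (fun j => if i < j then w i j else 0))
  have hcw : ∀ u v, c u v - c v u = w (p u) (p v) := by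
    have : c - c.flip = (w.compl₁₂ p p) := by
      ext i j
      simp only [c, p, LinearMap.coe_comp, Function.comp_apply, Finsupp.lsingle_apply,
        LinearMap.sub_apply, LinearMap.flip_apply, Finsupp.linearCombination_single, one_smul,
        LinearMap.compl₁₂_apply, id]
      rcases lt_trichotomy i j with h | h | h
      · simp [h, h.not_gt]
      · subst h; simp [hw]
      · simp [h, h.not_gt, hanti i j]
    intro u v
    exact DFunLike.congr_fun (DFunLike.congr_fun this u) v
  have hsymm : ∀ u v, p u = 0 → c v u = c u v := by
    intro u v hu
    have h := hcw u v
    rw [hu, map_zero, LinearMap.zero_apply] at h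
    exact (sub_eq_zero.mp h).symm
  obtain ⟨g, hg⟩ := sym_coc (B := LinearMap.ker p) (fun u v => c u.1 v.1)
    (fun u v => hsymm v.1 u.1 v.2) (by
      intro x y z
      simp only [Submodule.coe_add, map_add, LinearMap.add_apply]
      abel)
  let s : B → (B →₀ ℤ) := fun x => Finsupp.single x 1
  have hps : ∀ x, p (s x) = x := by intro x; simp [p, s]
  have hr0 : ∀ x y, p (s x + s y - s (x + y)) = 0 := by
    intro x y; rw [map_sub, map_add, hps, hps, hps, sub_self]
  let r : B → B → LinearMap.ker p := fun x y => ⟨s x + s y - s (x + y), hr0 x y⟩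
  have hrv : ∀ x y, s (x + y) = s x + s y - (r x y).1 := by
    intro x y; change _ = s x + s y - (s x + s y - s (x + y)); abel
  have hrs : ∀ x y, r x y = r y x := by
    intro x y; apply Subtype.ext
    change s x + s y - s (x + y) = s y + s x - s (y + x)
    rw [add_comm (s x), add_comm x]
  refine ⟨fun x y => c (s x) (s y) - c (r x y).1 (s (x + y)) + g (r x y), ?_, ?_⟩
  · intro x y
    have h := hcw (s x) (s y)
    rw [hps, hps] at h
    beta_reduce
    rw [← h, hrs y x, add_comm y x]
    abel
  · intro x y z
    have hT : r y z + r x (y + z) = r x y + r (x + y) z := by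
      apply Subtype.ext
      change (s y + s z - s (y + z)) + (s x + s (y + z) - s (x + (y + z)))
        = (s x + s y - s (x + y)) + (s (x + y) + s z - s (x + y + z))
      rw [add_assoc x y z]; abel
    have h4 : (r (x + y) z).1 = (r y z).1 + (r x (y + z)).1 - (r x y).1 := by
      have := congrArg Subtype.val hT
      simp only [Submodule.coe_add] at this
      rw [this]; abel
    have hg1 := hg (r y z) (r x (y + z))
    have hg2 := hg (r x y) (r (x + y) z)
    rw [← hT] at hg2
    have e1 : g (r y z) + g (r x (y + z)) - g (r (x + y) z) - g (r x y)
        = c (r y z).1 (r x (y + z)).1 - c (r x y).1 (r (x + y) z).1 := by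
      rw [hg1, hg2]; abel
    have k1 : ∀ v, c v (r y z).1 = c (r y z).1 v := fun v => hsymm _ v (r y z).2
    have k2 : ∀ v, c v (r x (y + z)).1 = c (r x (y + z)).1 v := fun v => hsymm _ v (r x (y + z)).2
    have k3 : ∀ v, c v (r x y).1 = c (r x y).1 v := fun v => hsymm _ v (r x y).2
    have e2 : (c (s y) (s z) - c (r y z).1 (s (y + z)))
        - (c (s (x + y)) (s z) - c (r (x + y) z).1 (s (x + y + z)))
        + (c (s x) (s (y + z)) - c (r x (y + z)).1 (s (x + (y + z))))
        - (c (s x) (s y) - c (r x y).1 (s (x + y)))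
        + (c (r y z).1 (r x (y + z)).1 - c (r x y).1 (r (x + y) z).1) = 0 := by
      rw [add_assoc x y z, h4, hrv x (y + z), hrv x y, hrv y z]
      generalize (r y z).1 = r1 at *
      generalize (r x (y + z)).1 = r2 at *
      generalize (r x y).1 = r3 at *
      simp only [map_add, map_sub, LinearMap.add_apply, LinearMap.sub_apply]
      simp only [k1 (s x), k1 r2, k1 r3, k2 r3]
      abel
    rw [← e1] at e2
    rw [← e2]
    beta_reduce
    abel

theorem barD2_single {B : Type*} [AddCommGroup B] (x y : B) :
    barD2 B (Finsupp.single (x, y) 1) =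
      Finsupp.single y 1 - Finsupp.single (x + y) 1 + Finsupp.single x 1 := by
  simp [barD2]

theorem barD3_single {B : Type*} [AddCommGroup B] (x y z : B) :
    barD3 B (Finsupp.single (x, y, z) 1) =
      Finsupp.single (y, z) 1 - Finsupp.single (x + y, z) 1 + Finsupp.single (x, y + z) 1
        - Finsupp.single (x, y) 1 := by
  simp [barD3]

theorem barD2_comp_barD3 (B : Type*) [AddCommGroup B] : barD2 B ∘ₗ barD3 B = 0 := by
  apply Finsupp.lhom_ext'
  rintro ⟨x, y, z⟩
  ext
  simp only [LinearMap.comp_apply, Finsupp.lsingle_apply, barD3_single, map_add, map_sub,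
    barD2_single, LinearMap.zero_apply, add_assoc]
  congr 1
  abel

/-- Pontrjagin product cycle. -/
noncomputable def pontCyc {B : Type*} [AddCommGroup B] (a b : B) : LinearMap.ker (barD2 B) :=
  ⟨Finsupp.single (a, b) 1 - Finsupp.single (b, a) 1, by
    rw [LinearMap.mem_ker, map_sub, barD2_single, barD2_single, add_comm b a]; abel⟩

noncomputable def pont {B : Type*} [AddCommGroup B] (a b : B) : H2 B :=
  Submodule.Quotient.mk (pontCyc a b)

theorem pont_self {B : Type*} [AddCommGroup B] (a : B) : pont a a = 0 := by
  have : pontCyc a a = 0 := Subtype.ext (sub_self _)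
  rw [pont, this, Submodule.Quotient.mk_zero]

theorem pont_swap {B : Type*} [AddCommGroup B] (a b : B) : pont a b = - pont b a := by
  have : pontCyc a b = - pontCyc b a := Subtype.ext (neg_sub _ _).symm
  rw [pont, this, Submodule.Quotient.mk_neg, pont]

theorem pont_add {B : Type*} [AddCommGroup B] (a a2 b : B) :
    pont (a + a2) b = pont a b + pont a2 b := by
  rw [pont, pont, pont, ← Submodule.Quotient.mk_add, eq_comm, Submodule.Quotient.eq]
  refine ⟨Finsupp.single (a, a2, b) 1 - Finsupp.single (a, b, a2) 1
    + Finsupp.single (b, a, a2) 1, ?_⟩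
  rw [map_add, map_sub, barD3_single, barD3_single, barD3_single, add_comm b a2, add_comm b a]
  change _ = (Finsupp.single (a, b) (1 : ℤ) - Finsupp.single (b, a) 1)
    + (Finsupp.single (a2, b) 1 - Finsupp.single (b, a2) 1)
    - (Finsupp.single (a + a2, b) 1 - Finsupp.single (b, a + a2) 1)
  abel

theorem pont_add_right {B : Type*} [AddCommGroup B] (a b b2 : B) :
    pont a (b + b2) = pont a b + pont a b2 := by
  rw [pont_swap, pont_add, neg_add, ← pont_swap, ← pont_swap]

noncomputable def pontBil (B : Type*) [AddCommGroup B] : B →+ B →+ H2 B :=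
  AddMonoidHom.mk' (fun a => AddMonoidHom.mk' (fun b => pont a b) (pont_add_right a))
    (fun a a2 => by ext b; exact pont_add a a2 b)

theorem pontBil_apply {B : Type*} [AddCommGroup B] (a b : B) : pontBil B a b = pont a b := rfl

noncomputable def pontAlt (B : Type*) [AddCommGroup B] : B [⋀^Fin 2]→ₗ[ℤ] H2 B where
  toFun v := pontBil B (v 0) (v 1)
  map_update_add' := by
    intro _ v i x y
    fin_cases i <;> simp [Function.update]
  map_update_smul' := by
    intro _ v i n x
    fin_cases i <;> simp [Function.update]
  map_eq_zero_of_eq' := by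
    intro v i j h hij
    have : v 0 = v 1 := by
      fin_cases i <;> fin_cases j <;> simp_all
    rw [this]
    exact pont_self _

noncomputable def pontMap (B : Type*) [AddCommGroup B] : ⋀[ℤ]^2 B →ₗ[ℤ] H2 B :=
  exteriorPower.alternatingMapLinearEquiv (pontAlt B)

theorem pontMap_wedge {B : Type*} [AddCommGroup B] (v : Fin 2 → B) :
    pontMap B (exteriorPower.ιMulti ℤ 2 v) = pont (v 0) (v 1) := by
  rw [pontMap, exteriorPower.alternatingMapLinearEquiv_apply_ιMulti]; rfl

theorem pontMap_inj (B : Type*) [AddCommGroup B] : Function.Injective (pontMap B) := by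
  rw [injective_iff_map_eq_zero]
  intro u hu
  apply CharacterModule.eq_zero_of_character_apply
  intro ch
  let χ : ⋀[ℤ]^2 B →ₗ[ℤ] QZ := AddMonoidHom.toIntLinearMap (ch : _ →+ QZ)
  change χ u = 0
  let al := exteriorPower.ιMulti ℤ 2 (M := B)
  let w : B →+ B →+ ⋀[ℤ]^2 B :=
    AddMonoidHom.mk' (fun a => AddMonoidHom.mk' (fun b => al ![a, b])
      (fun b b2 => by
        have := al.map_update_add ![a, 0] 1 b b2
        have hu1 : ∀ t : B, Function.update ![a, 0] 1 t = ![a, t] := by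
          intro t; ext i; fin_cases i <;> simp
        rw [hu1, hu1, hu1] at this
        exact this))
      (fun a a2 => by
        ext b : 1
        have := al.map_update_add ![0, b] 0 a a2
        have hu1 : ∀ t : B, Function.update ![0, b] 0 t = ![t, b] := by
          intro t; ext i; fin_cases i <;> simp
        rw [hu1, hu1, hu1] at this
        exact this)
  let w2 : B →ₗ[ℤ] B →ₗ[ℤ] QZ := LinearMap.mk₂ ℤ (fun a b => χ (w a b))
    (by intros; simp) (by intros; simp) (by intros; simp) (by intros; simp)
  obtain ⟨f, hf1, hf2⟩ := alt_coc w2 (by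
    intro x
    change χ (al ![x, x]) = 0
    rw [al.map_eq_zero_of_eq ![x, x] (i := 0) (j := 1) rfl (by simp), map_zero])
  let F : (B × B →₀ ℤ) →ₗ[ℤ] QZ := Finsupp.linearCombination ℤ (fun q : B × B => f q.1 q.2)
  have hF : F ∘ₗ barD3 B = 0 := by
    apply Finsupp.lhom_ext'
    rintro ⟨x, y, z⟩
    ext
    simp only [LinearMap.comp_apply, Finsupp.lsingle_apply, barD3_single, map_add, map_sub,
      LinearMap.zero_apply, F, Finsupp.linearCombination_single, one_smul]
    exact hf2 x y z
  let ψ : H2 B →ₗ[ℤ] QZ := Submodule.liftQ _ (F ∘ₗ (LinearMap.ker (barD2 B)).subtype) (by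
    rintro x ⟨t, ht⟩
    rw [LinearMap.mem_ker, LinearMap.comp_apply, ← ht]
    exact DFunLike.congr_fun hF t)
  have key : ψ ∘ₗ pontMap B = χ := by
    apply exteriorPower.linearMap_ext
    ext v
    change ψ (pontMap B (exteriorPower.ιMulti ℤ 2 v)) = χ (exteriorPower.ιMulti ℤ 2 v)
    rw [pontMap_wedge]
    change F (Finsupp.single (v 0, v 1) 1 - Finsupp.single (v 1, v 0) 1) = _
    simp only [map_sub, F, Finsupp.linearCombination_single, one_smul]
    rw [hf1]
    change χ (al ![v 0, v 1]) = χ (al v)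
    rw [show ![v 0, v 1] = v by ext i; fin_cases i <;> rfl]
  rw [← key, LinearMap.comp_apply, hu, map_zero]

theorem pontMap_surj (B : Type*) [AddCommGroup B] : Function.Surjective (pontMap B) := by
  apply CharacterModule.surjective_of_dual_injective
  rw [injective_iff_map_eq_zero]
  intro ch hch
  let χ : H2 B →ₗ[ℤ] QZ := AddMonoidHom.toIntLinearMap (ch : _ →+ QZ)
  have hχ : ∀ u, χ (pontMap B u) = 0 := fun u => DFunLike.congr_fun hch u
  let K := LinearMap.ker (barD2 B)
  obtain ⟨F, hF⟩ := (Module.Baer.of_divisible QZ).extension_property K.subtype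
    K.injective_subtype (χ ∘ₗ Submodule.mkQ _)
  have hFK : ∀ k : K, F k.1 = χ (Submodule.Quotient.mk k) := fun k => DFunLike.congr_fun hF k
  obtain ⟨g, hg⟩ := sym_coc (fun x y => F (Finsupp.single (x, y) 1))
    (by
      intro x y
      have h1 := hFK (pontCyc x y)
      have h2 := hχ (exteriorPower.ιMulti ℤ 2 ![x, y])
      rw [pontMap_wedge] at h2
      have h3 : F (Finsupp.single (x, y) 1 - Finsupp.single (y, x) 1) = 0 := h1.trans h2
      rw [map_sub] at h3
      exact sub_eq_zero.mp h3)
    (by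
      intro x y z
      have hk : barD3 B (Finsupp.single (x, y, z) 1) ∈ K :=
        DFunLike.congr_fun (barD2_comp_barD3 B) _
      have h1 := hFK ⟨_, hk⟩
      have h2 : (Submodule.Quotient.mk ⟨_, hk⟩ : H2 B) = 0 := by
        rw [Submodule.Quotient.mk_eq_zero]
        exact ⟨_, rfl⟩
      rw [h2, map_zero] at h1
      simp only [barD3_single, map_add, map_sub] at h1
      exact h1)
  have hfac : F = Finsupp.linearCombination ℤ g ∘ₗ barD2 B := by
    apply Finsupp.lhom_ext'
    rintro ⟨x, y⟩
    ext
    simp only [LinearMap.comp_apply, Finsupp.lsingle_apply, barD2_single, map_add, map_sub,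
      Finsupp.linearCombination_single, one_smul]
    rw [hg]; abel
  apply CharacterModule.ext
  intro h
  obtain ⟨k, rfl⟩ := Submodule.Quotient.mk_surjective _ h
  change χ (Submodule.Quotient.mk k) = 0
  rw [← hFK k, hfac, LinearMap.comp_apply, LinearMap.mem_ker.mp k.2, map_zero]

end helpers

/-- For any abelian group `B`, the second integral group homology `H₂(B;ℤ)` is isomorphic to
the exterior square `Λ²_ℤ B`, the isomorphism being induced by the Pontrjagin product. -/
theorem h2_iso_exterior_square (B : Type*) [AddCommGroup B] :
    Nonempty (H2 B ≃ₗ[ℤ] ⋀[ℤ]^2 B) := by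
  exact ⟨(LinearEquiv.ofBijective (pontMap B) ⟨pontMap_inj B, pontMap_surj B⟩).symm⟩
end
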